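/- For all λ ∈ [−δ_0,δ_0], ω ∈ ℝ, and u ∈ C_n^1 the following identities hold: A(λ,ω)C(λ,ω)u = 0; A(λ,ω)D(λ,ω)u = u; A(λ,ω)∂_uF(λ,ω,0)u = −B(λ)u; and (A(λ,ω)F(λ,ω,u))(x,t) = f(x,λ,u(x,t)) for all (x,t), where f = (f_1,…,f_n). -/

import Mathlib

open Real Set MeasureTheory Filter Topology

noncomputable section

instance fact_two_pi_pos : Fact (0 < 2 * Real.pi) := ⟨by positivity⟩

/-- The time circle of length `2π` (continuous `2π`-time-periodic functions of `t ∈ ℝ`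
are identified with continuous functions on this circle). -/
abbrev TimeCircle : Type := AddCircle (2 * Real.pi)

/-- The domain `[0,1] × (ℝ / 2πℤ)`. -/
abbrev Dom : Type := Set.Icc (0:ℝ) 1 × TimeCircle

/-- The Banach space `C_n` of continuous `2π`-time-periodic maps `u : [0,1] × ℝ → ℝⁿ`
with the sup-norm, realized as the space of continuous maps on the compact set `Dom`. -/
abbrev Cspace (n : ℕ) : Type := C(Dom, Fin n → ℝ)

/-- Evaluation of an element of `Cspace n` at real coordinates `(x,t)`
(extended constantly outside `[0,1]` in the `x`-variable). -/
def ev {n : ℕ} (u : Cspace n) (x t : ℝ) : Fin n → ℝ :=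
  u (Set.projIcc (0:ℝ) 1 zero_le_one x, (t : TimeCircle))

/-- The boundary point `x_j`: `0` for `j = 1,…,m` and `1` for `j = m+1,…,n`
(with 0-based indices: `0` for `j < m`, `1` for `j ≥ m`). -/
def xjv (m : ℕ) {n : ℕ} (j : Fin n) : ℝ := if (j : ℕ) < m then 0 else 1

/-- The data of the problem: coefficients `a_j(x,λ)`, nonlinearities `b_j(x,λ,u)`
and reflection coefficients `r_{jk}`, for a system of `n` equations with `m`
components running to the right. -/
structure HypData (n m : ℕ) where
  a : Fin n → ℝ → ℝ → ℝ
  b : Fin n → ℝ → ℝ → (Fin n → ℝ) → ℝ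
  r : Fin n → Fin n → ℝ

namespace HypData

variable {n m : ℕ} (d : HypData n m)

/-- `∂_{u_k} b_j (x, λ, 0)`. -/
def dbu (j k : Fin n) (x lam : ℝ) : ℝ := fderiv ℝ (d.b j x lam) 0 (Pi.single k 1)

/-- `∂²_{u_k u_l} b_j (x, λ, 0)`. -/
def dbu2 (j k l : Fin n) (x lam : ℝ) : ℝ :=
  fderiv ℝ (fun v => fderiv ℝ (d.b j x lam) v (Pi.single l 1)) 0 (Pi.single k 1)

/-- `∂³_{u_k u_l u_r} b_j (x, λ, 0)`. -/
def dbu3 (j k l rr : Fin n) (x lam : ℝ) : ℝ :=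
  fderiv ℝ (fun v =>
    fderiv ℝ (fun v' => fderiv ℝ (d.b j x lam) v' (Pi.single rr 1)) v (Pi.single l 1))
    0 (Pi.single k 1)

/-- The characteristic `τ_j(ξ,x,t,λ,ω) = ω ∫_x^ξ dη / a_j(η,λ) + t`. -/
def tau (j : Fin n) (ξ x t lam ω : ℝ) : ℝ := ω * (∫ η in x..ξ, (d.a j η lam)⁻¹) + t

/-- The weight `c_j(ξ,x,λ) = exp ∫_x^ξ ∂_{u_j}b_j(η,λ,0) / a_j(η,λ) dη`. -/
def cfac (j : Fin n) (ξ x lam : ℝ) : ℝ :=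
  Real.exp (∫ η in x..ξ, d.dbu j j η lam / d.a j η lam)

/-- `f_j(x,λ,u) = ∂_{u_j}b_j(x,λ,0) u_j − b_j(x,λ,u)`. -/
def ffun (j : Fin n) (x lam : ℝ) (u : Fin n → ℝ) : ℝ := d.dbu j j x lam * u j - d.b j x lam u

/-- The operator `C(λ,ω)` acting on (representations of) functions. -/
def CopRaw (lam ω : ℝ) (U : ℝ → ℝ → Fin n → ℝ) (x t : ℝ) (j : Fin n) : ℝ :=
  if (j : ℕ) < m then
    d.cfac j 0 x lam *
      ∑ k : Fin n, (if m ≤ (k : ℕ) then d.r j k * U 0 (d.tau j 0 x t lam ω) k else 0)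
  else
    d.cfac j 1 x lam *
      ∑ k : Fin n, (if (k : ℕ) < m then d.r j k * U 1 (d.tau j 1 x t lam ω) k else 0)

/-- The operator `F(λ,ω,·)` acting on (representations of) functions. -/
def FopRaw (lam ω : ℝ) (U : ℝ → ℝ → Fin n → ℝ) (x t : ℝ) (j : Fin n) : ℝ :=
  ∫ ξ in (xjv m j)..x,
    (d.cfac j ξ x lam / d.a j ξ lam) * d.ffun j ξ lam (U ξ (d.tau j ξ x t lam ω))

/-- The operator `D(λ,ω)`. -/
def DopRaw (lam ω : ℝ) (U : ℝ → ℝ → Fin n → ℝ) (x t : ℝ) (j : Fin n) : ℝ :=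
  ∫ ξ in (xjv m j)..x,
    (d.cfac j ξ x lam / d.a j ξ lam) * U ξ (d.tau j ξ x t lam ω) j

/-- The Fréchet derivative `∂_u F(λ,ω,0)` (explicit formula). -/
def dFRaw (lam ω : ℝ) (U : ℝ → ℝ → Fin n → ℝ) (x t : ℝ) (j : Fin n) : ℝ :=
  -∫ ξ in (xjv m j)..x,
    (d.cfac j ξ x lam / d.a j ξ lam) *
      ∑ k : Fin n, (if k ≠ j then d.dbu j k ξ lam * U ξ (d.tau j ξ x t lam ω) k else 0)

end HypData

/-- Partial derivative in `x` (within `[0,1]`). -/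
def pdx {n : ℕ} (U : ℝ → ℝ → Fin n → ℝ) (x t : ℝ) (j : Fin n) : ℝ :=
  derivWithin (fun y => U y t j) (Set.Icc 0 1) x

/-- Partial derivative in `t`. -/
def pdt {n : ℕ} (U : ℝ → ℝ → Fin n → ℝ) (x t : ℝ) (j : Fin n) : ℝ :=
  deriv (fun s => U x s j) t

/-- `U` represents an element of `C_n`: continuous on `[0,1] × ℝ` and `2π`-periodic in time. -/
def IsCnFun {n : ℕ} (U : ℝ → ℝ → Fin n → ℝ) : Prop :=
  ContinuousOn (fun p : ℝ × ℝ => U p.1 p.2) (Set.Icc 0 1 ×ˢ Set.univ) ∧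
  ∀ x t, U x (t + 2 * Real.pi) = U x t

/-- `U` represents an element of `C_n^1`: it is in `C_n` and has continuous
partial derivatives `∂_x U`, `∂_t U` on `[0,1] × ℝ`. -/
def IsCn1Fun {n : ℕ} (U : ℝ → ℝ → Fin n → ℝ) : Prop :=
  IsCnFun U ∧
  (∀ (j : Fin n) (t : ℝ), ∀ x ∈ Set.Icc (0:ℝ) 1,
      DifferentiableWithinAt ℝ (fun y => U y t j) (Set.Icc 0 1) x ∧
      DifferentiableAt ℝ (fun s => U x s j) t) ∧
  ContinuousOn (fun p : ℝ × ℝ => pdx U p.1 p.2) (Set.Icc 0 1 ×ˢ Set.univ) ∧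
  ContinuousOn (fun p : ℝ × ℝ => pdt U p.1 p.2) (Set.Icc 0 1 ×ˢ Set.univ)

/-- The sup-norm `‖U‖_∞ = sup { |U_j(x,t)| : x ∈ [0,1], t ∈ ℝ, j }`. -/
def supNorm {n : ℕ} (U : ℝ → ℝ → Fin n → ℝ) : ℝ :=
  sSup {y : ℝ | ∃ x ∈ Set.Icc (0:ℝ) 1, ∃ t : ℝ, ∃ j : Fin n, y = |U x t j|}

/-- The `C¹`-norm `‖U‖_∞ + ‖∂_x U‖_∞ + ‖∂_t U‖_∞`. -/
def c1Norm {n : ℕ} (U : ℝ → ℝ → Fin n → ℝ) : ℝ :=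
  supNorm U + supNorm (pdx U) + supNorm (pdt U)

/-- The `L²`-type pairing `⟨u,v⟩ = (1/2π) Σ_j ∫_0^{2π} ∫_0^1 u_j v_j dx dt`. -/
def pairing {n : ℕ} (U V : ℝ → ℝ → Fin n → ℝ) : ℝ :=
  (1 / (2 * Real.pi)) *
    ∑ j : Fin n, ∫ t in (0:ℝ)..(2 * Real.pi), ∫ x in (0:ℝ)..1, U x t j * V x t j

/-- The Hermitian pairing `⟨u,v⟩ = (1/2π) Σ_j ∫_0^{2π} ∫_0^1 u_j conj(v_j) dx dt`. -/
def pairingC {n : ℕ} (U : ℝ → ℝ → Fin n → ℝ) (V : ℝ → ℝ → Fin n → ℂ) : ℂ :=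
  (1 / (2 * Real.pi) : ℂ) *
    ∑ j : Fin n, ∫ t in (0:ℝ)..(2 * Real.pi), ∫ x in (0:ℝ)..1,
      (U x t j : ℂ) * starRingEnd ℂ (V x t j)

/-- The real part of the wave `v(x) e^{-it}`. -/
def reWave {n : ℕ} (v : Fin n → ℝ → ℂ) (x t : ℝ) (j : Fin n) : ℝ :=
  (v j x * Complex.exp (-(Complex.I * t))).re

/-- The imaginary part of the wave `v(x) e^{-it}`. -/
def imWave {n : ℕ} (v : Fin n → ℝ → ℂ) (x t : ℝ) (j : Fin n) : ℝ :=
  (v j x * Complex.exp (-(Complex.I * t))).im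

/-- A family of complex functions on `[0,1]` is nontrivial. -/
def Nontriv {n : ℕ} (v : Fin n → ℝ → ℂ) : Prop := ∃ j : Fin n, ∃ x ∈ Set.Icc (0:ℝ) 1, v j x ≠ 0

/-- The time shift operator `(S_φ u)(x,t) = u(x, t+φ)` on `Cspace n`. -/
def Sshift {n : ℕ} (φ : ℝ) (u : Cspace n) : Cspace n :=
  u.comp ⟨fun p => (p.1, p.2 + (φ : TimeCircle)), by continuity⟩

namespace HypData

variable {n m : ℕ} (d : HypData n m)

/-- The differential operator `A(λ,ω)`. -/
def AopRaw (lam ω : ℝ) (U : ℝ → ℝ → Fin n → ℝ) (x t : ℝ) (j : Fin n) : ℝ :=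
  ω * pdt U x t j + d.a j x lam * pdx U x t j + d.dbu j j x lam * U x t j

/-- The formally adjoint differential operator `Ã(λ,ω)`. -/
def AtilRaw (lam ω : ℝ) (U : ℝ → ℝ → Fin n → ℝ) (x t : ℝ) (j : Fin n) : ℝ :=
  -(ω * pdt U x t j) - derivWithin (fun y => d.a j y lam * U y t j) (Set.Icc 0 1) x +
    d.dbu j j x lam * U x t j

/-- The complex version of `Ã(λ,ω)` acting on complex-valued functions. -/
def AtilRawC (lam ω : ℝ) (W : ℝ → ℝ → Fin n → ℂ) (x t : ℝ) (j : Fin n) : ℂ :=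
  -((ω : ℂ) * deriv (fun s => W x s j) t) -
    derivWithin (fun y => (d.a j y lam : ℂ) * W y t j) (Set.Icc 0 1) x +
    (d.dbu j j x lam : ℂ) * W x t j

/-- The off-diagonal multiplication operator `B(λ)`. -/
def BopRaw (lam : ℝ) (U : ℝ → ℝ → Fin n → ℝ) (x t : ℝ) (j : Fin n) : ℝ :=
  ∑ k : Fin n, (if k ≠ j then d.dbu j k x lam * U x t k else 0)

/-- The reflection boundary conditions. -/
def SatBC (U : ℝ → ℝ → Fin n → ℝ) : Prop :=
  ∀ (t : ℝ) (j : Fin n),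
    ((j : ℕ) < m → U 0 t j = ∑ k : Fin n, (if m ≤ (k : ℕ) then d.r j k * U 0 t k else 0)) ∧
    (m ≤ (j : ℕ) → U 1 t j = ∑ k : Fin n, (if (k : ℕ) < m then d.r j k * U 1 t k else 0))

/-- The adjoint boundary conditions. -/
def SatAdjBC (lam : ℝ) (V : ℝ → ℝ → Fin n → ℝ) : Prop :=
  ∀ (t : ℝ) (j : Fin n),
    (m ≤ (j : ℕ) → d.a j 0 lam * V 0 t j
        = -∑ k : Fin n, (if (k : ℕ) < m then d.r k j * d.a k 0 lam * V 0 t k else 0)) ∧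
    ((j : ℕ) < m → d.a j 1 lam * V 1 t j
        = -∑ k : Fin n, (if m ≤ (k : ℕ) then d.r k j * d.a k 1 lam * V 1 t k else 0))

/-- `U` is a classical (`C¹`, `2π`-time-periodic) solution of the hyperbolic system
`ω ∂_t u_j + a_j(x,λ) ∂_x u_j + b_j(x,λ,u) = 0` with the reflection boundary conditions. -/
def IsClassicalSolution (lam ω : ℝ) (U : ℝ → ℝ → Fin n → ℝ) : Prop :=
  IsCn1Fun U ∧
  (∀ x ∈ Set.Ioo (0:ℝ) 1, ∀ (t : ℝ) (j : Fin n),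
      ω * pdt U x t j + d.a j x lam * pdx U x t j + d.b j x lam (U x t) = 0) ∧
  d.SatBC U

/-- The standing assumptions: `1 ≤ m ≤ n`, smoothness of the coefficients, hyperbolicity
`a_j(x,0) ≠ 0`, nondegeneracy `a_j(x,0) ≠ a_k(x,0)` for `j ≠ k`, the trivial solution
assumption `b_j(x,λ,0) = 0`, and nonvanishing of `a_j(x,λ)` for `|λ| ≤ δ₀`. -/
def StandingHyps (δ0 : ℝ) : Prop :=
  1 ≤ m ∧ m ≤ n ∧
  (∀ j, ContDiff ℝ (⊤ : ℕ∞) (fun p : ℝ × ℝ => d.a j p.1 p.2)) ∧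
  (∀ j, ContDiff ℝ (⊤ : ℕ∞) (fun p : ℝ × ℝ × (Fin n → ℝ) => d.b j p.1 p.2.1 p.2.2)) ∧
  (∀ j, ∀ x ∈ Set.Icc (0:ℝ) 1, d.a j x 0 ≠ 0) ∧
  (∀ j k, j ≠ k → ∀ x ∈ Set.Icc (0:ℝ) 1, d.a j x 0 ≠ d.a k x 0) ∧
  (∀ j x lam, d.b j x lam 0 = 0) ∧
  0 < δ0 ∧
  (∀ j, ∀ x ∈ Set.Icc (0:ℝ) 1, ∀ lam ∈ Set.Icc (-δ0) δ0, d.a j x lam ≠ 0)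

/-- The constant `R₀(λ)`. -/
def R0lam (lam : ℝ) : ℝ :=
  sSup {y : ℝ | ∃ j : Fin n, (j : ℕ) < m ∧ ∃ x ∈ Set.Icc (0:ℝ) 1,
    y = ∑ k : Fin n, (if m ≤ (k : ℕ) then
          |d.r j k| * Real.exp (-∫ η in (0:ℝ)..x, d.dbu j j η lam / d.a j η lam) else 0)}

/-- The constant `R₁(λ)`. -/
def R1lam (lam : ℝ) : ℝ :=
  sSup {y : ℝ | ∃ j : Fin n, m ≤ (j : ℕ) ∧ ∃ x ∈ Set.Icc (0:ℝ) 1,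
    y = ∑ k : Fin n, (if (k : ℕ) < m then
          |d.r j k| * Real.exp (∫ η in x..(1:ℝ), d.dbu j j η lam / d.a j η lam) else 0)}

/-- `R₀ = R₀(0)`. -/
def R0c : ℝ := d.R0lam 0

/-- `R₁ = R₁(0)`. -/
def R1c : ℝ := d.R1lam 0

/-- `v` solves the eigenvalue problem (EV) with parameters `λ`, `μ`. -/
def IsEV (lam : ℝ) (mu : ℂ) (v : Fin n → ℝ → ℂ) : Prop :=
  (∀ (j : Fin n), ∀ x ∈ Set.Icc (0:ℝ) 1, ∃ dv : ℂ,
      HasDerivWithinAt (v j) dv (Set.Icc 0 1) x ∧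
      (d.a j x lam : ℂ) * dv + ∑ k : Fin n, (d.dbu j k x lam : ℂ) * v k x = mu * v j x) ∧
  (∀ j : Fin n, (j : ℕ) < m →
      v j 0 = ∑ k : Fin n, (if m ≤ (k : ℕ) then (d.r j k : ℂ) * v k 0 else 0)) ∧
  (∀ j : Fin n, m ≤ (j : ℕ) →
      v j 1 = ∑ k : Fin n, (if (k : ℕ) < m then (d.r j k : ℂ) * v k 1 else 0))

/-- `w` solves the adjoint eigenvalue problem (AEV) with parameters `λ`, `ν`. -/
def IsAEV (lam : ℝ) (nu : ℂ) (w : Fin n → ℝ → ℂ) : Prop :=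
  (∀ (j : Fin n), ∀ x ∈ Set.Icc (0:ℝ) 1, ∃ dw : ℂ,
      HasDerivWithinAt (fun y => (d.a j y lam : ℂ) * w j y) dw (Set.Icc 0 1) x ∧
      -dw + ∑ k : Fin n, (d.dbu k j x lam : ℂ) * w k x = nu * w j x) ∧
  (∀ j : Fin n, m ≤ (j : ℕ) →
      (d.a j 0 lam : ℂ) * w j 0
        = -∑ k : Fin n, (if (k : ℕ) < m then (d.r k j : ℂ) * (d.a k 0 lam : ℂ) * w k 0 else 0)) ∧
  (∀ j : Fin n, (j : ℕ) < m →
      (d.a j 1 lam : ℂ) * w j 1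
        = -∑ k : Fin n, (if m ≤ (k : ℕ) then (d.r k j : ℂ) * (d.a k 1 lam : ℂ) * w k 1 else 0))

/-- Assumption (H1): for `λ = 0`, `μ = i` the eigenvalue problem has exactly one
nontrivial solution up to linear dependence. -/
def HypH1 : Prop :=
  ∃ v, d.IsEV 0 Complex.I v ∧ Nontriv v ∧
    ∀ v', d.IsEV 0 Complex.I v' → ∃ c : ℂ, ∀ (j : Fin n), ∀ x ∈ Set.Icc (0:ℝ) 1, v' j x = c * v j x

/-- Assumption (H2): algebraic simplicity. -/
def HypH2 : Prop :=
  ∀ v w, d.IsEV 0 Complex.I v → Nontriv v → d.IsAEV 0 (-Complex.I) w → Nontriv w →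
    (∑ j : Fin n, ∫ x in (0:ℝ)..1, v j x * starRingEnd ℂ (w j x)) ≠ 0

/-- Assumption (H4): nonresonance. -/
def HypH4 : Prop :=
  ∀ k : ℤ, (∃ v, d.IsEV 0 (Complex.I * k) v ∧ Nontriv v) → k = 1 ∨ k = -1

end HypData

/-- Normalization `Σ_j ∫_0^1 v⁰_j conj(w⁰_j) dx = 2`. -/
def NormalizedPair {n : ℕ} (v0 w0 : Fin n → ℝ → ℂ) : Prop :=
  (∑ j : Fin n, ∫ x in (0:ℝ)..1, v0 j x * starRingEnd ℂ (w0 j x)) = 2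

/-- The transversality quantity `α`. -/
def alphaVal {n m : ℕ} (d : HypData n m) (v0 v0' w0 : Fin n → ℝ → ℂ) : ℝ :=
  (1/2) * (∑ j : Fin n, ∫ x in (0:ℝ)..1,
    ((deriv (fun lam => d.a j x lam) 0 : ℂ) * v0' j x
      + ∑ k : Fin n, (deriv (fun lam => d.dbu j k x lam) 0 : ℂ) * v0 k x)
      * starRingEnd ℂ (w0 j x)).re

/-- The bifurcation-direction quantity `β`. -/
def betaVal {n m : ℕ} (d : HypData n m) (v0 w0 y z : Fin n → ℝ → ℂ) : ℝ :=
  -(∫ x in (0:ℝ)..1,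
      ((1/8 : ℂ) * ∑ j : Fin n, ∑ k : Fin n, ∑ l : Fin n, ∑ rr : Fin n,
          (d.dbu3 j k l rr x 0 : ℂ) * v0 k x * v0 l x *
            starRingEnd ℂ (v0 rr x) * starRingEnd ℂ (w0 j x)
        + ∑ j : Fin n, ∑ k : Fin n, ∑ l : Fin n,
          (d.dbu2 j k l x 0 : ℂ) * (y k x * starRingEnd ℂ (v0 l x) + z k x * v0 l x) *
            starRingEnd ℂ (w0 j x))).re

end
/-- The nearest-point retraction of `ℝ` onto `[0,1]`. -/
noncomputable def unitProj (x : ℝ) : ℝ := Set.projIcc (0:ℝ) 1 zero_le_one x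

lemma unitProj_mem (x : ℝ) : unitProj x ∈ Set.Icc (0:ℝ) 1 :=
  (Set.projIcc (0:ℝ) 1 zero_le_one x).2

lemma unitProj_of_mem {x : ℝ} (hx : x ∈ Set.Icc (0:ℝ) 1) : unitProj x = x := by
  simp [unitProj, Set.projIcc_of_mem zero_le_one hx]

lemma continuous_unitProj : Continuous unitProj :=
  continuous_subtype_val.comp continuous_projIcc

lemma uIcc_subset_unit {x y : ℝ} (hx : x ∈ Set.Icc (0:ℝ) 1) (hy : y ∈ Set.Icc (0:ℝ) 1) :
    Set.uIcc x y ⊆ Set.Icc (0:ℝ) 1 :=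
  (convex_Icc (0:ℝ) 1).ordConnected.uIcc_subset hx hy

/-- On `[0,1]`, an interval integral is the increment of the primitive of any continuous
function on `ℝ` agreeing with the integrand on `[0,1]`. -/
lemma integral_eq_sub_primitive {f g : ℝ → ℝ} (hg : Continuous g)
    (hfg : Set.EqOn f g (Set.Icc 0 1)) {x y : ℝ} (hx : x ∈ Set.Icc (0:ℝ) 1)
    (hy : y ∈ Set.Icc (0:ℝ) 1) :
    ∫ η in x..y, f η = (∫ η in (0:ℝ)..y, g η) - ∫ η in (0:ℝ)..x, g η := by
  rw [intervalIntegral.integral_interval_sub_left (hg.intervalIntegrable _ _)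
    (hg.intervalIntegrable _ _)]
  exact intervalIntegral.integral_congr fun η hη => hfg (uIcc_subset_unit hx hy hη)

/-- Differentiation of a parametric interval integral under the integral sign, for an integrand
with jointly continuous parameter derivative. -/
lemma hasDerivAt_parametric_integral {K K' : ℝ → ℝ → ℝ} (hK : Continuous (Function.uncurry K))
    (hK' : Continuous (Function.uncurry K')) (hd : ∀ ξ s, HasDerivAt (K ξ) (K' ξ s) s)
    (x₀ x s : ℝ) :
    HasDerivAt (fun s => ∫ ξ in x₀..x, K ξ s) (∫ ξ in x₀..x, K' ξ s) s := by
  obtain ⟨M, hM⟩ := ((isCompact_uIcc (a := x₀) (b := x)).prod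
    (isCompact_closedBall s (1:ℝ))).exists_bound_of_continuousOn hK'.continuousOn
  have hsec : ∀ s, Continuous fun ξ => K ξ s := fun s =>
    hK.comp (continuous_id.prodMk continuous_const)
  have hsec' : Continuous fun ξ => K' ξ s := hK'.comp (continuous_id.prodMk continuous_const)
  refine (intervalIntegral.hasDerivAt_integral_of_dominated_loc_of_deriv_le
    (F := fun s ξ => K ξ s) (F' := fun s ξ => K' ξ s) (bound := fun _ => M)
    (Metric.closedBall_mem_nhds s one_pos) ?_ ((hsec s).intervalIntegrable _ _)
    hsec'.aestronglyMeasurable ?_ intervalIntegrable_const ?_).2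
  · exact .of_forall fun s => (hsec s).aestronglyMeasurable
  · exact .of_forall fun ξ hξ r hr => hM (ξ, r) ⟨Set.uIoc_subset_uIcc hξ, hr⟩
  · exact .of_forall fun ξ _ r _ => hd ξ r

/-- Joint differentiability of an interval integral in its upper limit and a parameter. -/
lemma hasFDerivAt_parametric_primitive {K K' : ℝ → ℝ → ℝ}
    (hK : Continuous (Function.uncurry K)) (hK' : Continuous (Function.uncurry K'))
    (hd : ∀ ξ s, HasDerivAt (K ξ) (K' ξ s) s) (x₀ x s : ℝ) :
    HasFDerivAt (fun p : ℝ × ℝ => ∫ ξ in x₀..p.1, K ξ p.2)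
      ((ContinuousLinearMap.toSpanSingleton ℝ (K x s)).coprod
        (ContinuousLinearMap.toSpanSingleton ℝ (∫ ξ in x₀..x, K' ξ s))) (x, s) := by
  have hW' : Continuous fun p : ℝ × ℝ => ∫ ξ in x₀..p.1, K' ξ p.2 := by
    have hcont := intervalIntegral.continuous_parametric_intervalIntegral_of_continuous
      (μ := volume) (a₀ := x₀) (f := fun (p : ℝ × ℝ) ξ => K' ξ p.2) (s := fun p => p.1)
      (hK'.comp (continuous_snd.prodMk (continuous_snd.comp continuous_fst))) continuous_fst
    exact hcont
  have hspan : Continuous fun c : ℝ => ContinuousLinearMap.toSpanSingleton ℝ c :=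
    (ContinuousLinearMap.toSpanSingletonCLE (𝕜 := ℝ) (E := ℝ)).continuous
  refine (hasStrictFDerivAt_uncurry_coprod (𝕜 := ℝ) (u := (x, s))
    (f := fun x s => ∫ ξ in x₀..x, K ξ s)
    (f₁ := fun x s => ContinuousLinearMap.toSpanSingleton ℝ (K x s))
    (f₂ := fun x s => ContinuousLinearMap.toSpanSingleton ℝ (∫ ξ in x₀..x, K' ξ s))
    ?_ ?_ ?_ ?_).hasFDerivAt
  · refine .of_forall fun v => ?_
    have hsec : Continuous fun ξ => K ξ v.2 := hK.comp (continuous_id.prodMk continuous_const)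
    exact (hsec.integral_hasStrictDerivAt x₀ v.1).hasDerivAt.hasFDerivAt
  · exact .of_forall fun v => (hasDerivAt_parametric_integral hK hK' hd x₀ v.1 v.2).hasFDerivAt
  · exact (hspan.comp hK).continuousAt
  · exact (hspan.comp hW').continuousAt

/-- A first-order transport operator applied to `exp(-q(x)) W(x, t - ω p(x))`, where
`p' = 1/α` and `q' = β/α`, only sees the derivative of `W` in its first argument. -/
lemma transport_along_characteristics {V : ℝ → ℝ → ℝ} {W : ℝ × ℝ → ℝ} {p q : ℝ → ℝ}
    {L : ℝ × ℝ →L[ℝ] ℝ} {x t ω α β : ℝ} (hx : x ∈ Set.Icc (0:ℝ) 1) (hα : α ≠ 0)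
    (hp : HasDerivAt p α⁻¹ x) (hq : HasDerivAt q (β / α) x)
    (hV : ∀ y ∈ Set.Icc (0:ℝ) 1, ∀ s, V y s = Real.exp (-q y) * W (y, s - ω * p y))
    (hW : HasFDerivAt W L (x, t - ω * p x)) :
    ω * deriv (fun s => V x s) t + α * derivWithin (fun y => V y t) (Set.Icc 0 1) x
      + β * V x t = Real.exp (-q x) * (α * L (1, 0)) := by
  have ht : HasDerivAt (fun s => V x s) (Real.exp (-q x) * L (0, 1)) t := by
    have hline : HasDerivAt (fun s => (x, s - ω * p x)) ((0:ℝ), (1:ℝ)) t :=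
      (hasDerivAt_const t x).prodMk ((hasDerivAt_id t).sub_const _)
    have hcomp := (HasFDerivAt.comp_hasDerivAt t hW hline).const_mul (Real.exp (-q x))
    exact hcomp.congr_of_eventuallyEq (.of_forall fun s => hV x hx s)
  have hcurve : HasDerivAt (fun y => (y, t - ω * p y)) ((1:ℝ), -(ω * α⁻¹)) x :=
    (hasDerivAt_id x).prodMk ((hp.const_mul ω).const_sub t)
  have hxd : HasDerivAt (fun y => Real.exp (-q y) * W (y, t - ω * p y))
      (Real.exp (-q x) * -(β / α) * W (x, t - ω * p x)
        + Real.exp (-q x) * L (1, -(ω * α⁻¹))) x :=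
    hq.neg.exp.mul (HasFDerivAt.comp_hasDerivAt x hW hcurve)
  have hxw : HasDerivWithinAt (fun y => V y t) _ (Set.Icc 0 1) x :=
    hxd.hasDerivWithinAt.congr (fun y hy => hV y hy t) (hV x hx t)
  have hL : L (1, -(ω * α⁻¹)) = L (1, 0) - ω * α⁻¹ * L (0, 1) := by
    have hdec : ((1:ℝ), -(ω * α⁻¹)) = (1, 0) + (-(ω * α⁻¹)) • ((0:ℝ), (1:ℝ)) := by simp
    rw [hdec, map_add, map_smul, smul_eq_mul]
    ring
  rw [ht.deriv, hxw.derivWithin (uniqueDiffOn_Icc zero_lt_one x hx), hV x hx t, hL]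
  field_simp
  ring

lemma continuous_comp_unitProj {n : ℕ} {U : ℝ → ℝ → Fin n → ℝ}
    (hU : ContinuousOn (fun p : ℝ × ℝ => U p.1 p.2) (Set.Icc 0 1 ×ˢ Set.univ)) :
    Continuous fun p : ℝ × ℝ => U (unitProj p.1) p.2 :=
  hU.comp_continuous
    ((continuous_unitProj.comp continuous_fst).prodMk continuous_snd)
    fun p => ⟨unitProj_mem p.1, Set.mem_univ _⟩

lemma IsCn1Fun.hasDerivAt_time {n : ℕ} {U : ℝ → ℝ → Fin n → ℝ} (hU : IsCn1Fun U) {x : ℝ}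
    (hx : x ∈ Set.Icc (0:ℝ) 1) (t : ℝ) : HasDerivAt (U x) (pdt U x t) t :=
  hasDerivAt_pi.2 fun j => (hU.2.1 j t x hx).2.hasDerivAt

lemma xjv_mem (m : ℕ) {n : ℕ} (j : Fin n) : xjv m j ∈ Set.Icc (0:ℝ) 1 := by
  unfold xjv
  split_ifs <;> simp

namespace HypData

variable {n m : ℕ} {d : HypData n m} {δ0 lam : ℝ}

lemma StandingHyps.contDiff_a (hyp : d.StandingHyps δ0) (j : Fin n) (lam : ℝ) :
    ContDiff ℝ 1 fun x => d.a j x lam :=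
  ((hyp.2.2.1 j).of_le (by exact_mod_cast le_top)).comp (contDiff_id.prodMk contDiff_const)

lemma StandingHyps.contDiff_b (hyp : d.StandingHyps δ0) (j : Fin n) (lam : ℝ) :
    ContDiff ℝ 2 fun p : ℝ × (Fin n → ℝ) => d.b j p.1 lam p.2 :=
  ((hyp.2.2.2.1 j).of_le (WithTop.coe_le_coe.2 (le_top (a := (2 : ℕ∞))))).comp
    (contDiff_fst.prodMk (contDiff_const.prodMk contDiff_snd))

lemma StandingHyps.contDiff_dbu (hyp : d.StandingHyps δ0) (j k : Fin n) (lam : ℝ) :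
    ContDiff ℝ 1 fun x => d.dbu j k x lam :=
  (ContDiff.fderiv (m := 2) (n := 1) (f := fun x v => d.b j x lam v) (g := fun _ => 0)
    (hyp.contDiff_b j lam) contDiff_const (by norm_num)).clm_apply contDiff_const

lemma StandingHyps.a_ne_zero (hyp : d.StandingHyps δ0) (hlam : lam ∈ Set.Icc (-δ0) δ0)
    (j : Fin n) {x : ℝ} (hx : x ∈ Set.Icc (0:ℝ) 1) : d.a j x lam ≠ 0 :=
  hyp.2.2.2.2.2.2.2.2 j x hx lam hlam

lemma StandingHyps.continuous_inv_a (hyp : d.StandingHyps δ0) (hlam : lam ∈ Set.Icc (-δ0) δ0)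
    (j : Fin n) : Continuous fun x => (d.a j (unitProj x) lam)⁻¹ :=
  ((hyp.contDiff_a j lam).continuous.comp continuous_unitProj).inv₀
    fun x => hyp.a_ne_zero hlam j (unitProj_mem x)

lemma StandingHyps.continuous_dbu_div_a (hyp : d.StandingHyps δ0)
    (hlam : lam ∈ Set.Icc (-δ0) δ0) (j : Fin n) :
    Continuous fun x => d.dbu j j (unitProj x) lam / d.a j (unitProj x) lam :=
  ((hyp.contDiff_dbu j j lam).continuous.comp continuous_unitProj).div
    ((hyp.contDiff_a j lam).continuous.comp continuous_unitProj)
    fun x => hyp.a_ne_zero hlam j (unitProj_mem x)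

variable (d) in
/-- The travel-time primitive `∫_0^x dη / a_j(η,λ)`, extended linearly beyond `[0,1]`. -/
noncomputable def travelTime (j : Fin n) (lam x : ℝ) : ℝ := ∫ η in (0:ℝ)..x, (d.a j (unitProj η) lam)⁻¹

variable (d) in
/-- The primitive `∫_0^x ∂_{u_j}b_j(η,λ,0) / a_j(η,λ) dη`, extended linearly beyond `[0,1]`. -/
noncomputable def damping (j : Fin n) (lam x : ℝ) : ℝ :=
  ∫ η in (0:ℝ)..x, d.dbu j j (unitProj η) lam / d.a j (unitProj η) lam

lemma StandingHyps.hasDerivAt_travelTime (hyp : d.StandingHyps δ0)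
    (hlam : lam ∈ Set.Icc (-δ0) δ0) (j : Fin n) (x : ℝ) :
    HasDerivAt (d.travelTime j lam) (d.a j (unitProj x) lam)⁻¹ x :=
  ((hyp.continuous_inv_a hlam j).integral_hasStrictDerivAt 0 x).hasDerivAt

lemma StandingHyps.hasDerivAt_damping (hyp : d.StandingHyps δ0)
    (hlam : lam ∈ Set.Icc (-δ0) δ0) (j : Fin n) (x : ℝ) :
    HasDerivAt (d.damping j lam) (d.dbu j j (unitProj x) lam / d.a j (unitProj x) lam) x :=
  ((hyp.continuous_dbu_div_a hlam j).integral_hasStrictDerivAt 0 x).hasDerivAt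

lemma StandingHyps.tau_eq (hyp : d.StandingHyps δ0) (hlam : lam ∈ Set.Icc (-δ0) δ0)
    (j : Fin n) {ξ x : ℝ} (hξ : ξ ∈ Set.Icc (0:ℝ) 1) (hx : x ∈ Set.Icc (0:ℝ) 1) (t ω : ℝ) :
    d.tau j ξ x t lam ω
      = ω * d.travelTime j lam ξ + (t - ω * d.travelTime j lam x) := by
  rw [tau, integral_eq_sub_primitive (hyp.continuous_inv_a hlam j)
    (fun η hη => by simp only [unitProj_of_mem hη]) hx hξ, travelTime, travelTime]
  ring

lemma StandingHyps.cfac_eq (hyp : d.StandingHyps δ0) (hlam : lam ∈ Set.Icc (-δ0) δ0)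
    (j : Fin n) {ξ x : ℝ} (hξ : ξ ∈ Set.Icc (0:ℝ) 1) (hx : x ∈ Set.Icc (0:ℝ) 1) :
    d.cfac j ξ x lam = Real.exp (-d.damping j lam x) * Real.exp (d.damping j lam ξ) := by
  rw [cfac, integral_eq_sub_primitive (hyp.continuous_dbu_div_a hlam j)
    (fun η hη => by simp only [unitProj_of_mem hη]) hx hξ, ← Real.exp_add, damping, damping]
  ring_nf

/-- The operator `A(λ,ω)` applied to a function that factors through the characteristics. -/
lemma StandingHyps.AopRaw_eq (hyp : d.StandingHyps δ0) (hlam : lam ∈ Set.Icc (-δ0) δ0)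
    {ω : ℝ} {V : ℝ → ℝ → Fin n → ℝ} {j : Fin n} {W : ℝ × ℝ → ℝ} {L : ℝ × ℝ →L[ℝ] ℝ}
    {x t : ℝ} (hx : x ∈ Set.Icc (0:ℝ) 1)
    (hV : ∀ y ∈ Set.Icc (0:ℝ) 1, ∀ s,
      V y s j = Real.exp (-d.damping j lam y) * W (y, s - ω * d.travelTime j lam y))
    (hW : HasFDerivAt W L (x, t - ω * d.travelTime j lam x)) :
    d.AopRaw lam ω V x t j = Real.exp (-d.damping j lam x) * (d.a j x lam * L (1, 0)) := by
  have hp := hyp.hasDerivAt_travelTime hlam j x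
  have hq := hyp.hasDerivAt_damping hlam j x
  rw [unitProj_of_mem hx] at hp hq
  exact transport_along_characteristics (V := fun y s => V y s j) hx
    (hyp.a_ne_zero hlam j hx) hp hq hV hW

/-- Integrating `g(ξ, U)` along characteristics inverts `A(λ,ω)`. -/
lemma StandingHyps.AopRaw_integral (hyp : d.StandingHyps δ0) (hlam : lam ∈ Set.Icc (-δ0) δ0)
    {ω : ℝ} {U V : ℝ → ℝ → Fin n → ℝ} (hU : IsCn1Fun U) {j : Fin n} {g : ℝ → (Fin n → ℝ) → ℝ}
    (hg : ContDiff ℝ 1 (Function.uncurry g)) {x₀ : ℝ} (hx₀ : x₀ ∈ Set.Icc (0:ℝ) 1)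
    (hV : ∀ y ∈ Set.Icc (0:ℝ) 1, ∀ s, V y s j =
      ∫ ξ in x₀..y, (d.cfac j ξ y lam / d.a j ξ lam) * g ξ (U ξ (d.tau j ξ y s lam ω)))
    {x : ℝ} (hx : x ∈ Set.Icc (0:ℝ) 1) (t : ℝ) :
    d.AopRaw lam ω V x t j = g x (U x t) := by
  set p := d.travelTime j lam
  set q := d.damping j lam
  have hpc : Continuous p := continuous_iff_continuousAt.2 fun y =>
    (hyp.hasDerivAt_travelTime hlam j y).continuousAt
  have hqc : Continuous q := continuous_iff_continuousAt.2 fun y =>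
    (hyp.hasDerivAt_damping hlam j y).continuousAt
  let w : ℝ → ℝ := fun ξ => Real.exp (q ξ) * (d.a j (unitProj ξ) lam)⁻¹
  have hw : Continuous w := hqc.rexp.mul (hyp.continuous_inv_a hlam j)
  let K : ℝ → ℝ → ℝ := fun ξ s => w ξ * g (unitProj ξ) (U (unitProj ξ) (ω * p ξ + s))
  let K' : ℝ → ℝ → ℝ := fun ξ s => w ξ *
    fderiv ℝ (g (unitProj ξ)) (U (unitProj ξ) (ω * p ξ + s)) (pdt U (unitProj ξ) (ω * p ξ + s))
  have hshift : Continuous fun r : ℝ × ℝ => (r.1, ω * p r.1 + r.2) := by fun_prop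
  have hproj : Continuous fun r : ℝ × ℝ => unitProj r.1 :=
    continuous_unitProj.comp continuous_fst
  have hUc : Continuous fun r : ℝ × ℝ => U (unitProj r.1) (ω * p r.1 + r.2) :=
    (continuous_comp_unitProj hU.1.1).comp hshift
  have hUtc : Continuous fun r : ℝ × ℝ => pdt U (unitProj r.1) (ω * p r.1 + r.2) :=
    (continuous_comp_unitProj hU.2.2.2).comp hshift
  have hg' : Continuous fun r : ℝ × (Fin n → ℝ) => fderiv ℝ (g r.1) r.2 :=
    (ContDiff.fderiv (m := 1) (n := 0) (f := fun r : ℝ × (Fin n → ℝ) => g r.1)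
      (g := fun r => r.2) (hg.comp ((contDiff_fst.comp contDiff_fst).prodMk contDiff_snd))
      contDiff_snd (by norm_num)).continuous
  have hK : Continuous (Function.uncurry K) :=
    (hw.comp continuous_fst).mul (hg.continuous.comp (hproj.prodMk hUc))
  have hK' : Continuous (Function.uncurry K') :=
    (hw.comp continuous_fst).mul ((hg'.comp (hproj.prodMk hUc)).clm_apply hUtc)
  have hd : ∀ ξ s, HasDerivAt (K ξ) (K' ξ s) s := fun ξ s => by
    have hgd : Differentiable ℝ (g (unitProj ξ)) :=
      (hg.comp (contDiff_const.prodMk contDiff_id)).differentiable one_ne_zero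
    have hUd : HasDerivAt (fun s => U (unitProj ξ) (ω * p ξ + s)) _ s :=
      (hU.hasDerivAt_time (unitProj_mem ξ) (ω * p ξ + s)).comp_const_add (ω * p ξ) s
    exact (HasFDerivAt.comp_hasDerivAt s (hgd _).hasFDerivAt hUd).const_mul _
  rw [hyp.AopRaw_eq hlam hx (W := fun r : ℝ × ℝ => ∫ ξ in x₀..r.1, K ξ r.2) (fun y hy s => ?_)
    (hasFDerivAt_parametric_primitive hK hK' hd x₀ x (t - ω * p x))]
  · have ha := hyp.a_ne_zero hlam j hx
    simp only [K, w, ContinuousLinearMap.coprod_apply,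
      ContinuousLinearMap.toSpanSingleton_apply, one_smul, zero_smul, add_zero,
      unitProj_of_mem hx, add_sub_cancel]
    rw [Real.exp_neg]
    field_simp
    rfl
  · rw [hV y hy s, ← intervalIntegral.integral_const_mul]
    refine intervalIntegral.integral_congr fun ξ hξ => ?_
    have hξ' := uIcc_subset_unit hx₀ hy hξ
    simp only [K, w, hyp.cfac_eq hlam j hξ' hy, hyp.tau_eq hlam j hξ' hy, unitProj_of_mem hξ']
    ring

/-- Functions transported from a fixed boundary point are annihilated by `A(λ,ω)`. -/
lemma StandingHyps.AopRaw_boundary (hyp : d.StandingHyps δ0) (hlam : lam ∈ Set.Icc (-δ0) δ0)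
    {ω : ℝ} {V : ℝ → ℝ → Fin n → ℝ} {j : Fin n} {H : ℝ → ℝ} (hH : Differentiable ℝ H)
    {x₀ : ℝ} (hx₀ : x₀ ∈ Set.Icc (0:ℝ) 1)
    (hV : ∀ y s, V y s j = d.cfac j x₀ y lam * H (d.tau j x₀ y s lam ω))
    {x : ℝ} (hx : x ∈ Set.Icc (0:ℝ) 1) (t : ℝ) :
    d.AopRaw lam ω V x t j = 0 := by
  have hshift : HasFDerivAt (fun r : ℝ × ℝ => ω * d.travelTime j lam x₀ + r.2)
      (ContinuousLinearMap.snd ℝ ℝ ℝ) (x, t - ω * d.travelTime j lam x) :=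
    hasFDerivAt_snd.const_add _
  have hW := (HasDerivAt.comp_hasFDerivAt (x, t - ω * d.travelTime j lam x)
    (hH _).hasDerivAt hshift).const_mul (Real.exp (d.damping j lam x₀))
  rw [hyp.AopRaw_eq hlam hx (fun y hy s => ?_) hW]
  · simp
  · rw [hV, hyp.cfac_eq hlam j hx₀ hy, hyp.tau_eq hlam j hx₀ hy, mul_assoc, Function.comp_apply]

lemma StandingHyps.AopRaw_CopRaw (hyp : d.StandingHyps δ0) (hlam : lam ∈ Set.Icc (-δ0) δ0)
    (ω : ℝ) {U : ℝ → ℝ → Fin n → ℝ} (hU : IsCn1Fun U) {x : ℝ} (hx : x ∈ Set.Icc (0:ℝ) 1)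
    (t : ℝ) (j : Fin n) : d.AopRaw lam ω (d.CopRaw lam ω U) x t j = 0 := by
  have hdiff : ∀ (P : Fin n → Prop) [DecidablePred P], ∀ x₀ ∈ Set.Icc (0:ℝ) 1,
      Differentiable ℝ fun s => ∑ k : Fin n, (if P k then d.r j k * U x₀ s k else 0) := by
    intro P _ x₀ hx₀
    refine Differentiable.fun_sum fun k _ => ?_
    split_ifs
    · exact fun s => (hU.2.1 k s x₀ hx₀).2.const_mul _
    · exact differentiable_const _
  by_cases hj : (j : ℕ) < m
  · exact hyp.AopRaw_boundary hlam (x₀ := 0) (hdiff (fun k => m ≤ (k : ℕ)) 0 (by simp)) (by simp)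
      (fun y s => by simp only [CopRaw, if_pos hj]) hx t
  · exact hyp.AopRaw_boundary hlam (x₀ := 1) (hdiff (fun k => (k : ℕ) < m) 1 (by simp)) (by simp)
      (fun y s => by simp only [CopRaw, if_neg hj]) hx t

lemma StandingHyps.AopRaw_DopRaw (hyp : d.StandingHyps δ0) (hlam : lam ∈ Set.Icc (-δ0) δ0)
    (ω : ℝ) {U : ℝ → ℝ → Fin n → ℝ} (hU : IsCn1Fun U) {x : ℝ} (hx : x ∈ Set.Icc (0:ℝ) 1)
    (t : ℝ) (j : Fin n) : d.AopRaw lam ω (d.DopRaw lam ω U) x t j = U x t j :=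
  hyp.AopRaw_integral hlam hU (g := fun _ v => v j)
    ((contDiff_apply ℝ ℝ j).comp contDiff_snd) (xjv_mem m j) (fun _ _ _ => rfl) hx t

lemma StandingHyps.AopRaw_dFRaw (hyp : d.StandingHyps δ0) (hlam : lam ∈ Set.Icc (-δ0) δ0)
    (ω : ℝ) {U : ℝ → ℝ → Fin n → ℝ} (hU : IsCn1Fun U) {x : ℝ} (hx : x ∈ Set.Icc (0:ℝ) 1)
    (t : ℝ) (j : Fin n) :
    d.AopRaw lam ω (d.dFRaw lam ω U) x t j = -(d.BopRaw lam U x t j) := by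
  have hg : ContDiff ℝ 1 (Function.uncurry fun (ξ : ℝ) (v : Fin n → ℝ) =>
      -∑ k : Fin n, (if k ≠ j then d.dbu j k ξ lam * v k else 0)) := by
    refine ContDiff.neg (ContDiff.sum fun k _ => ?_)
    split_ifs
    · exact ((hyp.contDiff_dbu j k lam).comp contDiff_fst).mul
        ((contDiff_apply ℝ ℝ k).comp contDiff_snd)
    · exact contDiff_const
  refine hyp.AopRaw_integral hlam hU hg (xjv_mem m j) (fun y _ s => ?_) hx t
  simp only [dFRaw, mul_neg, intervalIntegral.integral_neg]

lemma StandingHyps.AopRaw_FopRaw (hyp : d.StandingHyps δ0) (hlam : lam ∈ Set.Icc (-δ0) δ0)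
    (ω : ℝ) {U : ℝ → ℝ → Fin n → ℝ} (hU : IsCn1Fun U) {x : ℝ} (hx : x ∈ Set.Icc (0:ℝ) 1)
    (t : ℝ) (j : Fin n) :
    d.AopRaw lam ω (d.FopRaw lam ω U) x t j = d.ffun j x lam (U x t) := by
  have hg : ContDiff ℝ 1 (Function.uncurry fun (ξ : ℝ) (v : Fin n → ℝ) => d.ffun j ξ lam v) :=
    (((hyp.contDiff_dbu j j lam).comp contDiff_fst).mul
      ((contDiff_apply ℝ ℝ j).comp contDiff_snd)).sub
      ((hyp.contDiff_b j lam).of_le one_le_two)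
  exact hyp.AopRaw_integral hlam hU hg (xjv_mem m j) (fun _ _ _ => rfl) hx t

end HypData

/-- **Identities relating `A(λ,ω)` to the integral operators:**
`A C(λ,ω)u = 0`, `A D(λ,ω)u = u`, `A ∂_uF(λ,ω,0)u = −B(λ)u`, and
`(A F(λ,ω,u))(x,t) = f(x,λ,u(x,t))`, for all `u ∈ C_n^1`. -/
theorem A_compositions {n m : ℕ} (d : HypData n m) (δ0 : ℝ)
    (hyp : d.StandingHyps δ0)
    (lam : ℝ) (hlam : lam ∈ Set.Icc (-δ0) δ0) (ω : ℝ)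
    (U : ℝ → ℝ → Fin n → ℝ) (hU : IsCn1Fun U) :
    ∀ x ∈ Set.Icc (0:ℝ) 1, ∀ (t : ℝ) (j : Fin n),
      d.AopRaw lam ω (d.CopRaw lam ω U) x t j = 0 ∧
      d.AopRaw lam ω (d.DopRaw lam ω U) x t j = U x t j ∧
      d.AopRaw lam ω (d.dFRaw lam ω U) x t j = -(d.BopRaw lam U x t j) ∧
      d.AopRaw lam ω (d.FopRaw lam ω U) x t j = d.ffun j x lam (U x t) := by
  exact fun x hx t j => ⟨hyp.AopRaw_CopRaw hlam ω hU hx t j, hyp.AopRaw_DopRaw hlam ω hU hx t j,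
    hyp.AopRaw_dFRaw hlam ω hU hx t j, hyp.AopRaw_FopRaw hlam ω hU hx t j⟩
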